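/- arXiv:2501.03725 — 2 statements merged into one kernel-verified Lean document; each statement's English description precedes it below -/
import Mathlib

section
/- If α > 1 and β > 0, then for every h ≥ 0, the ratio (∫₀^∞ e^{-rh} r^{-1} γ_{α,β}(r) dr) / (∫₀^∞ r^{-1} γ_{α,β}(r) dr) equals (1 + βh)^{-(α-1)}. (This is the sub-exponentially decaying autocorrelation AC_Y(h) of the supOU process when the recession-rate measure π has Gamma density γ_{α,β}.) -/
open MeasureTheory Set Real

/-- Gamma probability density with shape `α` and scale `β`. -/
noncomputable def gammaDensity (α β x : ℝ) : ℝ :=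
  x ^ (α - 1) * Real.exp (-x / β) / (Real.Gamma α * β ^ α)

theorem aux_int (α β h : ℝ) (hα : 1 < α) (hβ : 0 < β) (hh : 0 ≤ h) :
    (∫ r in Ioi (0:ℝ), Real.exp (-r * h) * r⁻¹ * gammaDensity α β r) =
      (Real.Gamma α * β ^ α)⁻¹ * ((β / (1 + β * h)) ^ (α - 1) * Real.Gamma (α - 1)) := by
  have hp : 0 < 1 + β * h := by positivity
  have hr : 0 < (1 + β * h) / β := by positivity
  have key := Real.integral_rpow_mul_exp_neg_mul_Ioi (sub_pos.mpr hα) hr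
  rw [one_div_div] at key
  rw [← key, ← integral_const_mul]
  refine setIntegral_congr_fun measurableSet_Ioi (fun t ht => ?_)
  have ht' : (0:ℝ) < t := ht
  have e1 : Real.exp (-((1 + β * h) / β * t)) = Real.exp (-t * h) * Real.exp (-t / β) := by
    rw [← Real.exp_add]
    congr 1
    field_simp
    ring
  simp only [gammaDensity]
  rw [e1, Real.rpow_sub_one ht'.ne' (α - 1)]
  ring

theorem stmt1 (α β h : ℝ) (hα : 1 < α) (hβ : 0 < β) (hh : 0 ≤ h) :
    (∫ r in Ioi (0:ℝ), Real.exp (-r * h) * r⁻¹ * gammaDensity α β r) /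
      (∫ r in Ioi (0:ℝ), r⁻¹ * gammaDensity α β r) =
      (1 + β * h) ^ (-(α - 1)) := by
  have h0 := aux_int α β 0 hα hβ le_rfl
  simp only [mul_zero, Real.exp_zero, one_mul, add_zero, div_one] at h0
  have hp : 0 < 1 + β * h := by positivity
  have hG := Real.Gamma_pos_of_pos (sub_pos.mpr hα)
  have hG' := Real.Gamma_pos_of_pos (zero_lt_one.trans hα)
  have hb := Real.rpow_pos_of_pos hβ α
  have hb' := Real.rpow_pos_of_pos hβ (α - 1)
  have hq := Real.rpow_pos_of_pos hp (α - 1)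
  rw [h0, aux_int α β h hα hβ hh, Real.div_rpow hβ.le hp.le, Real.rpow_neg hp.le]
  field_simp
end

section
/- For all P, R, r > 0 with P ≠ r and every h ≥ 0, the double integral ∫_{s=0}^∞ ∫_{u=-h}^∞ e^{-Rs - Pu - r|s-u|} du ds equals (1/(P+R)) · (1/(P+r) + 1/(R+r)) + (1/(R+r)) · (e^{(P-r)h} − 1)/(P − r). -/
open MeasureTheory Set Real

theorem stmt4_inner (P R r h s : ℝ) (hP : 0 < P) (hr : 0 < r)
    (hPr : P ≠ r) (hh : 0 ≤ h) (hs : 0 < s) :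
    ∫ u in Ioi (-h), Real.exp (-R * s - P * u - r * |s - u|) =
      (1 / (r - P) + 1 / (P + r)) * Real.exp (-(R + P) * s) +
        (-Real.exp ((P - r) * h) / (r - P)) * Real.exp (-(R + r) * s) := by
  have hne : r - P ≠ 0 := sub_ne_zero.mpr (Ne.symm hPr)
  have hle : -h ≤ s := by linarith
  have e1 : EqOn (fun u : ℝ => Real.exp (-R * s - P * u - r * |s - u|))
      (fun u => Real.exp (-(R + r) * s) * Real.exp ((r - P) * u)) (Ioc (-h) s) := by
    intro u hu
    simp only
    rw [abs_of_nonneg (by linarith [hu.2]), ← Real.exp_add]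
    congr 1; ring
  have e2 : EqOn (fun u : ℝ => Real.exp (-R * s - P * u - r * |s - u|))
      (fun u => Real.exp ((r - R) * s) * Real.exp (-(P + r) * u)) (Ioi s) := by
    intro u hu
    have hu' : s < u := hu
    simp only
    rw [abs_of_nonpos (by linarith), ← Real.exp_add]
    congr 1; ring
  have hneg : -(P + r) < 0 := by linarith
  have i2 : IntegrableOn (fun u : ℝ => Real.exp (-R * s - P * u - r * |s - u|)) (Ioi s) :=
    IntegrableOn.congr_fun ((integrableOn_exp_mul_Ioi hneg s).const_mul _) e2.symm
      measurableSet_Ioi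
  have i1 : IntegrableOn (fun u : ℝ => Real.exp (-R * s - P * u - r * |s - u|))
      (Ioc (-h) s) := by
    apply Continuous.integrableOn_Ioc
    fun_prop
  rw [← Ioc_union_Ioi_eq_Ioi hle, setIntegral_union (Ioc_disjoint_Ioi le_rfl)
    measurableSet_Ioi i1 i2, setIntegral_congr_fun measurableSet_Ioc e1,
    setIntegral_congr_fun measurableSet_Ioi e2, integral_const_mul, integral_const_mul,
    integral_exp_mul_Ioi hneg, ← intervalIntegral.integral_of_le hle,
    intervalIntegral.integral_comp_mul_left (fun x => Real.exp x) hne, integral_exp]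
  have a1 : Real.exp (-(R + P) * s) = Real.exp (-(R + r) * s) * Real.exp ((r - P) * s) := by
    rw [← Real.exp_add]; congr 1; ring
  have a2 : Real.exp (-(R + P) * s) = Real.exp ((r - R) * s) * Real.exp (-(P + r) * s) := by
    rw [← Real.exp_add]; congr 1; ring
  have a3 : (r - P) * -h = (P - r) * h := by ring
  have hs2 : P + r ≠ 0 := by positivity
  rw [add_mul (1 / (r - P)), a3]
  nth_rewrite 1 [a1]
  rw [a2, smul_eq_mul, neg_div_neg_eq]
  field_simp
  ring

theorem stmt4 (P R r h : ℝ) (hP : 0 < P) (hR : 0 < R) (hr : 0 < r)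
    (hPr : P ≠ r) (hh : 0 ≤ h) :
    ∫ s in Ioi (0:ℝ), ∫ u in Ioi (-h),
        Real.exp (-R * s - P * u - r * |s - u|) =
      (1 / (P + R)) * (1 / (P + r) + 1 / (R + r)) +
        (1 / (R + r)) * ((Real.exp ((P - r) * h) - 1) / (P - r)) := by
  have n1 : -(R + P) < 0 := by linarith
  have n2 : -(R + r) < 0 := by linarith
  rw [setIntegral_congr_fun measurableSet_Ioi
    (fun s hs => stmt4_inner P R r h s hP hr hPr hh hs),
    integral_add ((integrableOn_exp_mul_Ioi n1 0).const_mul _)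
      ((integrableOn_exp_mul_Ioi n2 0).const_mul _), integral_const_mul, integral_const_mul,
    integral_exp_mul_Ioi n1, integral_exp_mul_Ioi n2]
  simp only [mul_zero, Real.exp_zero, neg_div_neg_eq]
  have hne : P - r ≠ 0 := sub_ne_zero.mpr hPr
  have e : r - P = -(P - r) := by ring
  have h1 : R + P ≠ 0 := by positivity
  have h1' : P + R ≠ 0 := by positivity
  have h2 : R + r ≠ 0 := by positivity
  have h3 : P + r ≠ 0 := by positivity
  rw [e, add_comm R P]
  field_simp
  ring
end
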